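/- arXiv:2511.16994 — 2 statements merged into one kernel-verified Lean document; each statement's English description precedes it below -/
import Mathlib

section
/- Let U ⊆ ℂ be open, let u : U → ℂ be holomorphic, and let c ∈ ℂ. Define the operator L by (L g)(z) = g'(z) + c·u(z)·g(z). Then for every integer m ≥ 0 and every z ∈ U, the m-fold iterate satisfies (L^m u)(z) = Σ_{k=1}^{m+1} c^{k-1} · B_{m+1,k}(u(z), u'(z), …, u^{(m)}(z)), where u^{(j)} denotes the j-th derivative of u. -/
open Finset

/-- The exponential partial Bell polynomial `B_{m,k}(x 1, …, x (m-k+1))`. -/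
noncomputable def bellPartial (m k : ℕ) (x : ℕ → ℂ) : ℂ :=
  ∑ j ∈ (Fintype.piFinset (fun _ : Fin (m - k + 1) => Finset.range (m + 1))).filter
      (fun (j : Fin (m - k + 1) → ℕ) =>
        (∑ i : Fin (m - k + 1), j i) = k ∧
        (∑ i : Fin (m - k + 1), ((i : ℕ) + 1) * j i) = m),
    (Nat.factorial m : ℂ) / (∏ i : Fin (m - k + 1), (Nat.factorial (j i) : ℂ)) *
      ∏ i : Fin (m - k + 1),
        (x ((i : ℕ) + 1) / (Nat.factorial ((i : ℕ) + 1) : ℂ)) ^ (j i)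

/-- The operator `L = d/dz + c·u` acting on functions: `(L g)(z) = g'(z) + c·u(z)·g(z)`. -/
noncomputable def riccatiL (c : ℂ) (u : ℂ → ℂ) (g : ℂ → ℂ) : ℂ → ℂ :=
  fun z => deriv g z + c * u z * g z

/-- The power series `∑_{n ≥ 1} x n * t ^ n / n!`. -/
noncomputable def bellSeries (x : ℕ → ℂ) : PowerSeries ℂ :=
  PowerSeries.X * PowerSeries.mk fun n => x (n + 1) / (Nat.factorial (n + 1) : ℂ)

theorem coeff_zero_bellSeries (x : ℕ → ℂ) : PowerSeries.coeff 0 (bellSeries x) = 0 := by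
  simp [bellSeries]

theorem coeff_succ_bellSeries (x : ℕ → ℂ) (n : ℕ) :
    PowerSeries.coeff (n + 1) (bellSeries x) = x (n + 1) / (Nat.factorial (n + 1) : ℂ) := by
  simp [bellSeries, PowerSeries.coeff_succ_X_mul]

theorem coeff_bellSeries_pow_of_lt (x : ℕ → ℂ) {m k : ℕ} (h : m < k) :
    PowerSeries.coeff m (bellSeries x ^ k) = 0 := by
  rw [bellSeries, mul_pow, PowerSeries.coeff_X_pow_mul', if_neg (by omega)]

theorem coeff_mk_pow (a : ℕ → ℂ) (n k : ℕ) :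
    PowerSeries.coeff n (PowerSeries.mk a ^ k) =
      ∑ j ∈ (Finset.piAntidiag (Finset.univ : Finset (Fin (n + 1))) k).filter
        (fun j => ∑ i : Fin (n + 1), (i : ℕ) * j i = n),
        (Nat.multinomial Finset.univ j : ℂ) * ∏ i : Fin (n + 1), a i ^ j i := by
  set P : PowerSeries ℂ :=
    ∑ i : Fin (n + 1), PowerSeries.C (a i) * (PowerSeries.X : PowerSeries ℂ) ^ (i : ℕ) with hP
  have hdvd : (PowerSeries.X : PowerSeries ℂ) ^ (n + 1) ∣ PowerSeries.mk a - P := by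
    rw [PowerSeries.X_pow_dvd_iff]
    intro d hd
    rw [map_sub, hP, map_sum, Finset.sum_eq_single (⟨d, hd⟩ : Fin (n + 1))]
    · simp
    · intro b _ hb
      have : d ≠ (b : ℕ) := fun h => hb (Fin.ext h.symm)
      simp [PowerSeries.coeff_X_pow, this]
    · simp
  have hcoeff : PowerSeries.coeff n (PowerSeries.mk a ^ k) = PowerSeries.coeff n (P ^ k) := by
    have h := PowerSeries.X_pow_dvd_iff.1 (hdvd.trans (sub_dvd_pow_sub_pow _ _ k)) n
      (Nat.lt_succ_self n)
    rwa [map_sub, sub_eq_zero] at h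
  rw [hcoeff, hP, Finset.sum_pow_eq_sum_piAntidiag, map_sum, Finset.sum_filter]
  refine Finset.sum_congr rfl fun j _ => ?_
  have hprod : ∏ i : Fin (n + 1),
      (PowerSeries.C (a i) * (PowerSeries.X : PowerSeries ℂ) ^ (i : ℕ)) ^ j i =
      PowerSeries.C (∏ i : Fin (n + 1), a i ^ j i) *
        PowerSeries.X ^ (∑ i : Fin (n + 1), (i : ℕ) * j i) := by
    simp only [mul_pow, ← pow_mul, Finset.prod_mul_distrib, Finset.prod_pow_eq_pow_sum, map_prod,
      map_pow]
  rw [hprod, ← map_natCast (PowerSeries.C (R := ℂ)), PowerSeries.coeff_C_mul,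
    PowerSeries.coeff_C_mul, PowerSeries.coeff_X_pow]
  by_cases h : ∑ i : Fin (n + 1), (i : ℕ) * j i = n
  · simp [h]
  · simp [h, Ne.symm h]

theorem bellPartial_eq_coeff (x : ℕ → ℂ) {m k : ℕ} (hkm : k ≤ m) :
    bellPartial m k x = (Nat.factorial m : ℂ) / (Nat.factorial k : ℂ) *
      PowerSeries.coeff m (bellSeries x ^ k) := by
  rw [bellSeries, mul_pow, PowerSeries.coeff_X_pow_mul', if_pos hkm, coeff_mk_pow, bellPartial,
    Finset.mul_sum]
  have hweight (j : Fin (m - k + 1) → ℕ) :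
      ∑ i : Fin (m - k + 1), ((i : ℕ) + 1) * j i =
        ∑ i : Fin (m - k + 1), (i : ℕ) * j i + ∑ i, j i := by
    simp only [add_mul, one_mul, Finset.sum_add_distrib]
  refine Finset.sum_congr ?_ fun j hj => ?_
  · ext j
    simp only [Finset.mem_filter, Fintype.mem_piFinset, Finset.mem_range, Finset.mem_piAntidiag,
      hweight]
    constructor
    · rintro ⟨-, h1, h2⟩
      exact ⟨⟨h1, by simp⟩, by omega⟩
    · rintro ⟨⟨h1, -⟩, h2⟩
      replace h1 : ∑ i, j i = k := h1
      refine ⟨fun i => ?_, h1, by omega⟩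
      have := Finset.single_le_sum (f := j) (fun _ _ => Nat.zero_le _) (Finset.mem_univ i)
      omega
  · have hsum : ∑ i, j i = k := (Finset.mem_piAntidiag.1 (Finset.mem_filter.1 hj).1).1
    have hspec : (∏ i, (Nat.factorial (j i) : ℂ)) * (Nat.multinomial Finset.univ j : ℂ) =
        (Nat.factorial k : ℂ) := by
      have h := Nat.multinomial_spec Finset.univ j
      rw [hsum] at h
      exact_mod_cast h
    have hne : (∏ i, (Nat.factorial (j i) : ℂ)) ≠ 0 :=
      Finset.prod_ne_zero_iff.2 fun i _ => Nat.cast_ne_zero.2 (Nat.factorial_ne_zero _)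
    have hmul : (Nat.multinomial Finset.univ j : ℂ) ≠ 0 := by
      intro h
      rw [h, mul_zero] at hspec
      exact Nat.cast_ne_zero.2 (Nat.factorial_ne_zero k) hspec.symm
    rw [← hspec]
    field_simp

/-- Coefficientwise power rule for a family of power series depending on a parameter. -/
theorem hasDerivAt_coeff_pow {F : ℂ → PowerSeries ℂ} {F' : PowerSeries ℂ} {z : ℂ}
    (hF : ∀ n, HasDerivAt (fun w => PowerSeries.coeff n (F w)) (PowerSeries.coeff n F') z)
    (k n : ℕ) :
    HasDerivAt (fun w => PowerSeries.coeff n (F w ^ (k + 1)))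
      (PowerSeries.coeff n (((k + 1 : ℕ) : PowerSeries ℂ) * F z ^ k * F')) z := by
  induction k generalizing n with
  | zero => simpa using hF n
  | succ k ih =>
    have h : HasDerivAt (fun w => ∑ p ∈ Finset.HasAntidiagonal.antidiagonal n,
        PowerSeries.coeff p.1 (F w ^ (k + 1)) * PowerSeries.coeff p.2 (F w)) _ z :=
      HasDerivAt.fun_sum fun p _ => (ih p.1).mul (hF p.2)
    simp only [pow_succ _ (k + 1), PowerSeries.coeff_mul _ (F _ ^ (k + 1)) (F _)]
    refine h.congr_deriv ?_
    rw [Finset.sum_add_distrib, ← PowerSeries.coeff_mul, ← PowerSeries.coeff_mul, ← map_add]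
    congr 1
    push_cast
    ring

theorem hasDerivAt_coeff_bellSeries_pow {u : ℂ → ℂ} {z : ℂ} (hu : AnalyticAt ℂ u z) (k n : ℕ) :
    HasDerivAt
      (fun w => PowerSeries.coeff n (bellSeries (fun j => iteratedDeriv (j - 1) u w) ^ (k + 1)))
      ((n + 1) * PowerSeries.coeff (n + 1)
          (bellSeries (fun j => iteratedDeriv (j - 1) u z) ^ (k + 1)) -
        (k + 1) * u z * PowerSeries.coeff n
          (bellSeries (fun j => iteratedDeriv (j - 1) u z) ^ k)) z := by
  set F := fun w => bellSeries (fun j => iteratedDeriv (j - 1) u w) with hFdef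
  have hF (n : ℕ) : HasDerivAt (fun w => PowerSeries.coeff n (F w))
      (PowerSeries.coeff n (PowerSeries.derivative ℂ (F z) - PowerSeries.C (u z))) z := by
    rw [map_sub, PowerSeries.coeff_derivative]
    cases n with
    | zero => simpa [hFdef, coeff_zero_bellSeries, coeff_succ_bellSeries] using
        hasDerivAt_const z (0 : ℂ)
    | succ n =>
      have hd : HasDerivAt (iteratedDeriv n u) (iteratedDeriv (n + 1) u z) z := by
        rw [iteratedDeriv_succ]
        rw [iteratedDeriv_eq_iterate]
        exact (hu.iterated_deriv n).differentiableAt.hasDerivAt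
      simp only [hFdef, coeff_succ_bellSeries, Nat.add_sub_cancel]
      refine (hd.div_const (Nat.factorial (n + 1) : ℂ)).congr_deriv ?_
      have h1 : (Nat.factorial (n + 1) : ℂ) ≠ 0 := Nat.cast_ne_zero.2 (Nat.factorial_ne_zero _)
      have h2 : ((n : ℂ) + 1 + 1) ≠ 0 := by exact_mod_cast Nat.succ_ne_zero (n + 1)
      rw [Nat.factorial_succ (n + 1), PowerSeries.coeff_C, if_neg (Nat.succ_ne_zero n)]
      push_cast
      field_simp
      ring
  refine (hasDerivAt_coeff_pow hF k n).congr_deriv ?_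
  have hpow : ((k + 1 : ℕ) : PowerSeries ℂ) * F z ^ k *
      (PowerSeries.derivative ℂ (F z) - PowerSeries.C (u z)) =
      PowerSeries.derivative ℂ (F z ^ (k + 1)) -
        PowerSeries.C ((k + 1) * u z) * F z ^ k := by
    rw [Derivation.leibniz_pow]
    simp
    ring
  rw [hpow, map_sub, PowerSeries.coeff_derivative, PowerSeries.coeff_C_mul]
  ring

theorem riccatiL_iterate_eq_sum_coeff {U : Set ℂ} (hU : IsOpen U) {u : ℂ → ℂ}
    (hu : DifferentiableOn ℂ u U) (c : ℂ) (m : ℕ) {N : ℕ} (hN : m + 1 ≤ N) {z : ℂ} (hz : z ∈ U) :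
    (riccatiL c u)^[m] u z = ∑ k ∈ Finset.range N, c ^ k *
      ((Nat.factorial (m + 1) : ℂ) / (Nat.factorial (k + 1) : ℂ) * PowerSeries.coeff (m + 1)
        (bellSeries (fun j => iteratedDeriv (j - 1) u z) ^ (k + 1))) := by
  induction m generalizing z N with
  | zero =>
    rw [Finset.sum_eq_single_of_mem 0 (Finset.mem_range.2 hN)]
    · simp [coeff_succ_bellSeries]
    · intro k _ hk
      rw [coeff_bellSeries_pow_of_lt _ (by omega)]
      simp
  | succ m ih =>
    have hN' : m + 1 ≤ N := by omega
    have hderiv := HasDerivAt.fun_sum (u := Finset.range N) fun k _ =>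
      ((hasDerivAt_coeff_bellSeries_pow (hu.analyticAt (hU.mem_nhds hz)) k (m + 1)).const_mul
        ((Nat.factorial (m + 1) : ℂ) / (Nat.factorial (k + 1) : ℂ))).const_mul (c ^ k)
    have heq : (riccatiL c u)^[m] u =ᶠ[nhds z] _ :=
      Filter.eventuallyEq_of_mem (hU.mem_nhds hz) fun w hw => ih hN' hw
    rw [Function.iterate_succ_apply', riccatiL, heq.deriv_eq, hderiv.deriv, ih hN' hz,
      Finset.mul_sum, ← Finset.sum_add_distrib]
    set F := bellSeries (fun j => iteratedDeriv (j - 1) u z) with hF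
    have htel := Finset.sum_range_sub (fun k => u z * (c ^ k *
      ((Nat.factorial (m + 1) : ℂ) / (Nat.factorial k : ℂ) *
        PowerSeries.coeff (m + 1) (F ^ k)))) N
    rw [hF, coeff_bellSeries_pow_of_lt _ (by omega : m + 1 < N), ← hF] at htel
    simp only [pow_zero, PowerSeries.coeff_one, Nat.succ_ne_zero, if_false, mul_zero,
      sub_zero] at htel
    rw [← sub_eq_zero, ← Finset.sum_sub_distrib, ← htel]
    refine Finset.sum_congr rfl fun k _ => ?_
    have h1 : (Nat.factorial k : ℂ) ≠ 0 := Nat.cast_ne_zero.2 (Nat.factorial_ne_zero _)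
    have h2 : ((k : ℂ) + 1) ≠ 0 := Nat.cast_add_one_ne_zero k
    rw [Nat.factorial_succ (m + 1), Nat.factorial_succ k]
    push_cast
    field_simp
    ring

/-- For holomorphic `u` on an open set `U` and `c ∈ ℂ`, the iterate `L^m u` has the
Bell-polynomial expansion `(L^m u)(z) = ∑_{k=1}^{m+1} c^{k-1} B_{m+1,k}(u, u', …, u^{(m)})(z)`. -/
theorem riccatiL_iterate_bell (U : Set ℂ) (hU : IsOpen U) (u : ℂ → ℂ)
    (hu : DifferentiableOn ℂ u U) (c : ℂ) (m : ℕ) (z : ℂ) (hz : z ∈ U) :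
    (riccatiL c u)^[m] u z
      = ∑ k ∈ Finset.Icc 1 (m + 1),
          c ^ (k - 1) * bellPartial (m + 1) k (fun j => iteratedDeriv (j - 1) u z) := by
  rw [riccatiL_iterate_eq_sum_coeff hU hu c m le_rfl hz, ← Finset.Ico_add_one_right_eq_Icc,
    Finset.sum_Ico_eq_sum_range]
  refine Finset.sum_congr (by simp) fun k hk => ?_
  rw [Finset.mem_range] at hk
  rw [bellPartial_eq_coeff _ (by omega), add_comm 1 k, Nat.add_sub_cancel]
end

section
/- Let m ≥ 1 and c ∈ ℂ with c ≠ 0. If ξ ∈ ℂ^m is a nonzero solution of the indicial equations −k·ξ_k = f_k^A(ξ) for k = 1,…,m, then there exists an integer n ∈ {1,…,m} such that ξ_k = (n)_k / c for 1 ≤ k ≤ n and ξ_k = 0 for n < k ≤ m, where (n)_k = n(n−1)⋯(n−k+1) is the falling factorial. -/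
/-- The autonomous Riccati chain vector field on `ℂ^m`:
`f_k(x) = x_{k+1} − c·x_1·x_k` for `1 ≤ k ≤ m−1` and `f_m(x) = −c·x_1·x_m`
(here indices are shifted so that `k : Fin m` represents the coordinate `k+1`). -/
def riccatiField (m : ℕ) (c : ℂ) (x : Fin m → ℂ) (k : Fin m) : ℂ :=
  (if h : (k : ℕ) + 1 < m then x ⟨(k : ℕ) + 1, h⟩ else 0) - c * x ⟨0, k.pos⟩ * x k

/-- A sequence with `y (k+1) = (s - (k+1)) y k`, `y 0 ≠ 0`, that vanishes at `m` forces
`s` to be a positive integer at most `m`. -/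
theorem exists_nat_eq_of_recurrence_vanishing {R : Type*} [Ring R] [NoZeroDivisors R]
    {s : R} {y : ℕ → R} (hrec : ∀ k, y (k + 1) = (s - (k + 1)) * y k) (h0 : y 0 ≠ 0)
    {m : ℕ} (hm : y m = 0) : ∃ n : ℕ, 1 ≤ n ∧ n ≤ m ∧ s = n := by
  induction m with
  | zero => exact absurd hm h0
  | succ k ih =>
    rw [hrec, mul_eq_zero] at hm
    rcases hm with hs | hk
    · exact ⟨k + 1, by omega, le_rfl, by simpa using sub_eq_zero.mp hs⟩
    · obtain ⟨n, h1, hn, hs⟩ := ih hk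
      exact ⟨n, h1, by omega, hs⟩

/-- The falling factorials satisfy `(n)_{k+1} = (n - k) (n)_k` in any ring. -/
theorem cast_descFactorial_succ {R : Type*} [Ring R] (n k : ℕ) :
    (n.descFactorial (k + 1) : R) = (n - k) * n.descFactorial k := by
  rw [Nat.descFactorial_succ]
  rcases le_or_gt k n with h | h
  · rw [Nat.cast_mul, Nat.cast_sub h]
  · simp [Nat.descFactorial_of_lt h]

/-- Every nonzero solution of the indicial equations `−k·ξ_k = f_k(ξ)` of the
autonomous Riccati chain is one of the vectors `ξ^{(n)}`, `n ∈ {1,…,m}`, given by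
`ξ_k = (n)_k / c` for `k ≤ n` and `ξ_k = 0` for `k > n`. -/
theorem riccatiField_indicial_classification (m : ℕ) (hm : 1 ≤ m) (c : ℂ) (hc : c ≠ 0)
    (ξ : Fin m → ℂ) (hξ0 : ξ ≠ 0)
    (hξ : ∀ k : Fin m, -(((k : ℕ) + 1 : ℂ)) * ξ k = riccatiField m c ξ k) :
    ∃ n : ℕ, 1 ≤ n ∧ n ≤ m ∧ ∀ k : Fin m,
      ξ k = if (k : ℕ) + 1 ≤ n then (Nat.descFactorial n ((k : ℕ) + 1) : ℂ) / c else 0 := by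
  set y : ℕ → ℂ := fun k => if h : k < m then ξ ⟨k, h⟩ else 0 with hy
  have hyξ (k : Fin m) : y k = ξ k := by simp [hy]
  have hrec (k : ℕ) : y (k + 1) = (c * y 0 - (k + 1)) * y k := by
    rcases lt_or_ge k m with hk | hk
    · have h := hξ ⟨k, hk⟩
      have h0 : y 0 = ξ ⟨0, hm⟩ := hyξ ⟨0, hm⟩
      have hk' : y k = ξ ⟨k, hk⟩ := hyξ ⟨k, hk⟩
      change _ = y (k + 1) - c * ξ ⟨0, hm⟩ * ξ ⟨k, hk⟩ at h
      rw [h0, hk']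
      linear_combination -h
    · simp [hy, hk.not_gt, show ¬ k + 1 < m by omega]
  have hy0 : y 0 ≠ 0 := by
    intro h0
    have hzero (k : ℕ) : y k = 0 := by
      induction k with
      | zero => exact h0
      | succ k ih => rw [hrec, ih, mul_zero]
    exact hξ0 (funext fun k => by rw [← hyξ, hzero, Pi.zero_apply])
  obtain ⟨n, hn1, hnm, hn⟩ :=
    exists_nat_eq_of_recurrence_vanishing hrec hy0 (m := m) (by simp [hy])
  have hdesc (k : ℕ) : y k = (n.descFactorial (k + 1) : ℂ) / c := by
    induction k with
    | zero =>
      rw [eq_div_iff hc, mul_comm, hn]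
      simp
    | succ k ih =>
      rw [hrec, ih, hn, cast_descFactorial_succ n (k + 1)]
      push_cast
      ring
  refine ⟨n, hn1, hnm, fun k => ?_⟩
  rw [← hyξ, hdesc]
  split_ifs with h
  · rfl
  · rw [Nat.descFactorial_of_lt (not_le.mp h), Nat.cast_zero, zero_div]
end
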